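/- If Ψ : ℝ → ℝ is an even continuous function such that Ψ(t) → 0 as t → ∞, and λ̇ : [0,1] → ℝ is continuous, then the irreversible work W_irr(τ) = (1/2)∫₀¹∫₀¹ Ψ(τ(u−v)) λ̇(u) λ̇(v) du dv tends to 0 as τ → ∞. -/

import Mathlib

open MeasureTheory Real Filter

/-- An even function that decays at `+∞` vanishes in the limit under any nonzero rescaling. -/
theorem tendsto_comp_mul_const_of_even {f : ℝ → ℝ} (hf : ∀ t, f t = f (-t))
    (hlim : Tendsto f atTop (nhds 0)) {c : ℝ} (hc : c ≠ 0) :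
    Tendsto (fun x => f (x * c)) atTop (nhds 0) := by
  rcases lt_or_gt_of_ne hc with h | h
  · have := hlim.comp (tendsto_id.atTop_mul_const (neg_pos.2 h))
    refine this.congr fun x => ?_
    rw [hf (x * c)]
    simp
  · exact hlim.comp (tendsto_id.atTop_mul_const h)

/-- Quasistatic limit: if the even, bounded, continuous relaxation function
`Ψ` decays to zero, then the linear-response irreversible work
`W_irr(τ) = (1/2)∫₀¹∫₀¹ Ψ(τ(u−v)) λ̇(u) λ̇(v) du dv` tends to `0` as `τ → ∞`. -/
theorem irr_work_tendsto_zero_quasistatic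
    (Ψ : ℝ → ℝ) (hΨcont : Continuous Ψ)
    (hΨbdd : ∃ M, ∀ t, |Ψ t| ≤ M)
    (hΨeven : ∀ t, Ψ t = Ψ (-t))
    (hΨdecay : Tendsto Ψ atTop (nhds 0))
    (l : ℝ → ℝ) (hl : Continuous l) :
    Tendsto
      (fun τ : ℝ =>
        (1 / 2) * ∫ u in (0:ℝ)..1, ∫ v in (0:ℝ)..1, Ψ (τ * (u - v)) * l u * l v)
      atTop (nhds 0) := by
  obtain ⟨M, hM⟩ := hΨbdd
  obtain ⟨L, hL⟩ := (isCompact_Icc (a := (0 : ℝ)) (b := 1)).exists_bound_of_continuousOn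
    hl.continuousOn
  have hM0 : 0 ≤ M := (abs_nonneg _).trans (hM 0)
  have hL0 : 0 ≤ L := (norm_nonneg _).trans (hL 0 (by simp))
  have mem_Icc {x : ℝ} (hx : x ∈ Set.uIoc (0 : ℝ) 1) : x ∈ Set.Icc (0 : ℝ) 1 := by
    rw [Set.uIoc_of_le zero_le_one] at hx
    exact Set.Ioc_subset_Icc_self hx
  have bound (τ : ℝ) {u v : ℝ} (hu : u ∈ Set.uIoc (0 : ℝ) 1) (hv : v ∈ Set.uIoc (0 : ℝ) 1) :
      ‖Ψ (τ * (u - v)) * l u * l v‖ ≤ M * L * L := by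
    rw [norm_mul, norm_mul]
    gcongr
    · exact hM _
    · exact hL u (mem_Icc hu)
    · exact hL v (mem_Icc hv)
  have inner {u : ℝ} (hu : u ∈ Set.uIoc (0 : ℝ) 1) :
      Tendsto (fun τ : ℝ => ∫ v in (0:ℝ)..1, Ψ (τ * (u - v)) * l u * l v) atTop (nhds 0) := by
    have := intervalIntegral.tendsto_integral_filter_of_dominated_convergence
      (μ := volume) (a := 0) (b := 1) (l := atTop) (f := fun _ : ℝ => (0 : ℝ))
      (F := fun τ v : ℝ => Ψ (τ * (u - v)) * l u * l v) (fun _ => M * L * L)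
      (.of_forall fun τ => (by fun_prop : Continuous _).aestronglyMeasurable)
      (.of_forall fun τ => .of_forall fun v hv => bound τ hu hv)
      intervalIntegrable_const ?_
    · simpa using this
    · filter_upwards [Measure.ae_ne volume u] with v hv _
      simpa using ((tendsto_comp_mul_const_of_even hΨeven hΨdecay
        (sub_ne_zero.2 hv.symm)).mul_const (l u)).mul_const (l v)
  have outer := intervalIntegral.tendsto_integral_filter_of_dominated_convergence
    (μ := volume) (a := 0) (b := 1) (l := atTop) (f := fun _ : ℝ => (0 : ℝ))
    (F := fun τ u : ℝ => ∫ v in (0:ℝ)..1, Ψ (τ * (u - v)) * l u * l v) (fun _ => M * L * L)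
    (.of_forall fun τ =>
      (intervalIntegral.continuous_parametric_intervalIntegral_of_continuous'
        (by fun_prop) 0 1).aestronglyMeasurable)
    (.of_forall fun τ => .of_forall fun u hu => by
      simpa using intervalIntegral.norm_integral_le_of_norm_le_const
        (fun v hv => bound τ hu hv))
    intervalIntegrable_const
    (.of_forall fun u hu => inner hu)
  simpa using outer.const_mul (1 / 2 : ℝ)
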